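/- (Termination bound for ε-improving update sequences.) Let G be a finite connected simple graph on a vertex set V of n ≥ 2 players, let O be a finite set of resources, let ε > 1 be real, and set L = log n / log ε. Let P(0), P(1), …, P(T) be a sequence of allocations such that for every t < T there is a player i_t with: P(t+1) agrees with P(t) on every player except i_t, r_{i_t}(P(t+1)) ≥ ε·r_{i_t}(P(t)), and |{k ∈ V : r_k(P(t)) ≥ r_{i_t}(P(t+1))}| ≤ n − 2. Then T ≤ n²·D^{L}. -/

import Mathlib

open Finset

noncomputable section

variable {V O : Type*} [Fintype V] [DecidableEq V] [Fintype O] [DecidableEq O]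

/-- Diameter of the graph: maximum graph distance between any two vertices. -/
def csrDiam (G : SimpleGraph V) : ℕ :=
  Finset.sup Finset.univ fun i => Finset.sup Finset.univ fun j => G.dist i j

/-- Distance from player `i` to the nearest holder of resource `o` under allocation `P`;
`csrDiam G + 1` if no one holds `o`. -/
def csrDist (G : SimpleGraph V) (P : V → O) (i : V) (o : O) : ℕ :=
  if h : (Finset.univ.filter fun j => P j = o).Nonempty then
    (Finset.univ.filter fun j => P j = o).inf' h fun j => G.dist i j
  else csrDiam G + 1

/-- Cost of player `i` under allocation `P`. -/
def csrCost (G : SimpleGraph V) (P : V → O) (i : V) : ℕ :=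
  ∑ o ∈ Finset.univ.filter (fun o => o ≠ P i), csrDist G P i o

/-- Total cost of allocation `P`. -/
def csrTotal (G : SimpleGraph V) (P : V → O) : ℕ := ∑ i, csrCost G P i

/-- Radius of player `i`: distance to nearest *other* player holding the same resource;
`csrDiam G` if there is none. -/
def csrRadius (G : SimpleGraph V) (P : V → O) (i : V) : ℕ :=
  if h : (Finset.univ.filter fun j => j ≠ i ∧ P j = P i).Nonempty then
    (Finset.univ.filter fun j => j ≠ i ∧ P j = P i).inf' h fun j => G.dist i j
  else csrDiam G

/-- Ball of radius `r` (a natural number) around `i`. -/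
def csrBall (G : SimpleGraph V) (i : V) (r : ℕ) : Finset V :=
  Finset.univ.filter fun j => G.dist i j ≤ r

/-- Pure Nash equilibrium of the CSR game. -/
def csrIsNE (G : SimpleGraph V) (P : V → O) : Prop :=
  ∀ (i : V) (o : O), csrCost G P i ≤ csrCost G (Function.update P i o) i

theorem aux_le_diam (G : SimpleGraph V) (i j : V) : G.dist i j ≤ csrDiam G := by
  unfold csrDiam
  exact le_trans (Finset.le_sup (f := fun j => G.dist i j) (Finset.mem_univ j))
    (Finset.le_sup (f := fun i => Finset.sup Finset.univ fun j => G.dist i j) (Finset.mem_univ i))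

theorem aux_radius_le_dist (G : SimpleGraph V) (P : V → O) (i j : V) (h : j ≠ i)
    (hP : P j = P i) : csrRadius G P i ≤ G.dist i j := by
  have hm : j ∈ Finset.univ.filter (fun j => j ≠ i ∧ P j = P i) := by simp [h, hP]
  unfold csrRadius
  rw [dif_pos ⟨j, hm⟩]
  exact Finset.inf'_le _ hm

theorem aux_le_radius (G : SimpleGraph V) (P : V → O) (i : V) (m : ℕ) (hm : m ≤ csrDiam G)
    (h : ∀ j, j ≠ i → P j = P i → m ≤ G.dist i j) : m ≤ csrRadius G P i := by
  unfold csrRadius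
  split_ifs with hh
  · apply Finset.le_inf'
    intro j hj
    simp only [Finset.mem_filter, Finset.mem_univ, true_and] at hj
    exact h j hj.1 hj.2
  · exact hm

theorem aux_radius_le_diam (G : SimpleGraph V) (P : V → O) (i : V) :
    csrRadius G P i ≤ csrDiam G := by
  by_cases h : ∃ j, j ≠ i ∧ P j = P i
  · obtain ⟨j, h1, h2⟩ := h
    exact (aux_radius_le_dist G P i j h1 h2).trans (aux_le_diam G i j)
  · unfold csrRadius
    rw [dif_neg]
    rintro ⟨j, hj⟩
    simp only [Finset.mem_filter, Finset.mem_univ, true_and] at hj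
    exact h ⟨j, hj⟩

theorem aux_radius_pos (G : SimpleGraph V) (hconn : G.Connected) (hn : 2 ≤ Fintype.card V)
    (P : V → O) (i : V) : 1 ≤ csrRadius G P i := by
  apply aux_le_radius
  · obtain ⟨a, b, hab⟩ := Fintype.exists_pair_of_one_lt_card (α := V) (by omega)
    exact le_trans (hconn.pos_dist_of_ne hab) (aux_le_diam G a b)
  · intro j hj _
    exact hconn.pos_dist_of_ne hj.symm

theorem aux_other (G : SimpleGraph V) (P Q : V → O) (i k : V) (hk : k ≠ i)
    (hQ : ∀ k, k ≠ i → Q k = P k) :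
    min (csrRadius G P k) (csrRadius G Q i) ≤ csrRadius G Q k := by
  apply aux_le_radius
  · exact (min_le_left _ _).trans (aux_radius_le_diam G P k)
  · intro j hj hjk
    by_cases hji : j = i
    · subst hji
      rw [G.dist_comm]
      exact (min_le_right _ _).trans (aux_radius_le_dist G Q j k hk hjk.symm)
    · apply (min_le_left _ _).trans
      apply aux_radius_le_dist G P k j hj
      rw [← hQ j hji, ← hQ k hk, hjk]

theorem aux_step (G : SimpleGraph V) (hconn : G.Connected)
    (hn : 2 ≤ Fintype.card V) (ε : ℝ) (hε : 1 < ε) (L : ℝ) (hL : 0 < L)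
    (hεL : ε ^ L = Fintype.card V) (P Q : V → O) (i : V)
    (h1 : ∀ k : V, k ≠ i → Q k = P k)
    (h2 : ε * (csrRadius G P i : ℝ) ≤ (csrRadius G Q i : ℝ))
    (h3 : (Finset.univ.filter fun k : V => csrRadius G Q i ≤ csrRadius G P k).card
        ≤ Fintype.card V - 2) :
    ∑ k, (csrRadius G Q k : ℝ) ^ (-L) + (csrDiam G : ℝ) ^ (-L)
      ≤ ∑ k, (csrRadius G P k : ℝ) ^ (-L) := by
  have anti : ∀ a b : ℕ, 1 ≤ a → a ≤ b → (b : ℝ) ^ (-L) ≤ (a : ℝ) ^ (-L) := by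
    intro a b ha hab
    apply Real.rpow_le_rpow_of_nonpos
    · exact_mod_cast ha
    · exact_mod_cast hab
    · linarith
  have posP := aux_radius_pos G hconn hn P
  have posQ := aux_radius_pos G hconn hn Q
  set c : ℝ := (csrRadius G Q i : ℝ) ^ (-L) with hc
  have hc0 : 0 ≤ c := by positivity
  have hDc : (csrDiam G : ℝ) ^ (-L) ≤ c := anti _ _ (posQ i) (aux_radius_le_diam G Q i)
  have hnpos : (0 : ℝ) < Fintype.card V := by
    have : 0 < Fintype.card V := by omega
    exact_mod_cast this
  have hi : (Fintype.card V : ℝ) * c ≤ (csrRadius G P i : ℝ) ^ (-L) := by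
    have hr : (0 : ℝ) < csrRadius G P i := by exact_mod_cast posP i
    have : c ≤ (ε * (csrRadius G P i : ℝ)) ^ (-L) :=
      Real.rpow_le_rpow_of_nonpos (by positivity) h2 (by linarith)
    rw [Real.mul_rpow (by positivity) (by positivity), Real.rpow_neg (by positivity) L, hεL] at this
    calc _ ≤ (Fintype.card V : ℝ) * ((Fintype.card V : ℝ)⁻¹ * (csrRadius G P i : ℝ) ^ (-L)) := by
          gcongr
      _ = _ := by field_simp
  have key : ∀ k, (csrRadius G Q k : ℝ) ^ (-L) ≤ (csrRadius G P k : ℝ) ^ (-L) +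
      ((if csrRadius G Q i ≤ csrRadius G P k then c else 0) +
       (if k = i then -(((Fintype.card V : ℝ) - 1) * c) else 0)) := by
    intro k
    by_cases hk : k = i
    · subst hk
      rw [if_pos rfl]
      have : 0 ≤ (if csrRadius G Q k ≤ csrRadius G P k then c else 0) := by
        split_ifs <;> linarith
      rw [← hc]
      linarith
    · rw [if_neg hk]
      have ho := aux_other G P Q i k hk h1
      have hp : 0 ≤ (csrRadius G P k : ℝ) ^ (-L) := by positivity
      split_ifs with hle
      · rw [min_eq_right hle] at ho
        have := anti _ _ (posQ i) ho
        linarith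
      · rw [min_eq_left (by omega)] at ho
        have := anti _ _ (posP k) ho
        linarith
  have hs := Finset.sum_le_sum fun k (_ : k ∈ (Finset.univ : Finset V)) => key k
  rw [Finset.sum_add_distrib, Finset.sum_add_distrib, Finset.sum_ite_eq' , if_pos (Finset.mem_univ i),
    ← Finset.sum_filter, Finset.sum_const, nsmul_eq_mul] at hs
  have h3' : ((Finset.univ.filter fun k : V => csrRadius G Q i ≤ csrRadius G P k).card : ℝ)
      ≤ (Fintype.card V : ℝ) - 2 := by
    rw [le_sub_iff_add_le]
    have := Nat.add_le_of_le_sub hn h3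
    exact_mod_cast this
  have := mul_le_mul_of_nonneg_right h3' hc0
  linarith

/-- Termination bound for ε-improving update sequences. With
`L = log n / log ε`, any sequence of allocations in which at each step some player's
radius grows by a factor of at least `ε` (and at most `n - 2` players `k` have
`r_k(P(t)) ≥ r_{i_t}(P(t+1))`) has length at most `n² · D^L`. -/
theorem stmt12 (G : SimpleGraph V) (hconn : G.Connected)
    (hn : 2 ≤ Fintype.card V) (ε : ℝ) (hε : 1 < ε)
    (T : ℕ) (P : ℕ → V → O)
    (hstep : ∀ t < T, ∃ i : V,
      (∀ k : V, k ≠ i → P (t + 1) k = P t k) ∧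
      ε * (csrRadius G (P t) i : ℝ) ≤ (csrRadius G (P (t + 1)) i : ℝ) ∧
      (Finset.univ.filter fun k : V =>
          csrRadius G (P (t + 1)) i ≤ csrRadius G (P t) k).card
        ≤ Fintype.card V - 2) :
    (T : ℝ) ≤ (Fintype.card V : ℝ) ^ 2 *
      (csrDiam G : ℝ) ^ (Real.log (Fintype.card V) / Real.log ε) := by
  set L : ℝ := Real.log (Fintype.card V) / Real.log ε with hLdef
  have hn1 : (1 : ℝ) < Fintype.card V := by
    have : 1 < Fintype.card V := by omega
    exact_mod_cast this
  have hlε : 0 < Real.log ε := Real.log_pos hε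
  have hL : 0 < L := div_pos (Real.log_pos hn1) hlε
  have hεL : ε ^ L = Fintype.card V := by
    rw [Real.rpow_def_of_pos (by linarith), hLdef, mul_div_cancel₀ _ hlε.ne',
      Real.exp_log (by linarith)]
  have hind : ∀ t ≤ T, ∑ k, (csrRadius G (P t) k : ℝ) ^ (-L) + t * (csrDiam G : ℝ) ^ (-L)
      ≤ ∑ k, (csrRadius G (P 0) k : ℝ) ^ (-L) := by
    intro t
    induction t with
    | zero => intro _; simp
    | succ t ih =>
      intro ht
      obtain ⟨i, h1, h2, h3⟩ := hstep t (by omega)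
      have := aux_step G hconn hn ε hε L hL hεL (P t) (P (t + 1)) i h1 h2 h3
      have := ih (by omega)
      push_cast
      linarith
  have hT := hind T le_rfl
  have hpos : 0 ≤ ∑ k, (csrRadius G (P T) k : ℝ) ^ (-L) :=
    Finset.sum_nonneg fun k _ => by positivity
  have hup : ∑ k, (csrRadius G (P 0) k : ℝ) ^ (-L) ≤ Fintype.card V := by
    calc _ ≤ ∑ k : V, (1 : ℝ) := by
          apply Finset.sum_le_sum
          intro k _
          apply Real.rpow_le_one_of_one_le_of_nonpos
          · exact_mod_cast aux_radius_pos G hconn hn (P 0) k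
          · linarith
      _ = _ := by simp
  obtain ⟨a, b, hab⟩ := Fintype.exists_pair_of_one_lt_card (α := V) (by omega)
  have hD : (0 : ℝ) < csrDiam G := by
    exact_mod_cast lt_of_lt_of_le (hconn.pos_dist_of_ne hab) (aux_le_diam G a b)
  have hDL : 0 < (csrDiam G : ℝ) ^ L := Real.rpow_pos_of_pos hD L
  have hTn : (T : ℝ) * ((csrDiam G : ℝ) ^ L)⁻¹ ≤ Fintype.card V := by
    rw [← Real.rpow_neg hD.le]; linarith
  rw [← div_eq_mul_inv, div_le_iff₀ hDL] at hTn
  refine hTn.trans ?_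
  gcongr
  nlinarith
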